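/- Let $T_{q_0} = \langle X_n, Q, \pi, \lambda \rangle$ be an initial one-way synchronizing transducer (possibly asynchronous) equal to its core, representing a homeomorphism of $\mathfrak{C}_n$, with inverse $S_{(\epsilon,q_0)} = \langle X_n, Q', \pi', \lambda' \rangle$. Let $A = \langle X_n, Q', \pi', (\epsilon,q_0) \rangle$ be the automaton obtained from $S$ by forgetting outputs. Then $V_n^{T_{q_0}} = V_{\sim_A}$, where $V_n^{T_{q_0}} = T_{q_0}^{-1} V_n T_{q_0}$. -/

import Mathlib

open Classical

noncomputable section

/-- `n`-ary Cantor space: infinite words over the alphabet `Fin n`. -/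
abbrev Cantor (n : ℕ) : Type := ℕ → Fin n

/-- The finite word `w` is a prefix of the infinite word `χ`. -/
def PrefixOf {n : ℕ} (w : List (Fin n)) (χ : Cantor n) : Prop :=
  ∀ (i : ℕ) (h : i < w.length), w.get ⟨i, h⟩ = χ i

/-- Concatenation of a finite word with an infinite word. -/
def appendInf {n : ℕ} (w : List (Fin n)) (χ : Cantor n) : Cantor n :=
  fun i => if h : i < w.length then w.get ⟨i, h⟩ else χ (i - w.length)

/-- The cone (basic clopen set) of infinite words having the finite word `w` as prefix. -/
def cone {n : ℕ} (w : List (Fin n)) : Set (Cantor n) :=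
  {χ | PrefixOf w χ}

/-- The length-`k` prefix of an infinite word, as a finite word. -/
def takeW {n : ℕ} (χ : Cantor n) (k : ℕ) : List (Fin n) :=
  List.ofFn (fun i : Fin k => χ i)

/-- A finite family of finite words forming a maximal antichain:
every infinite word has exactly one member of the family as a prefix. -/
def AntichainFam {n m : ℕ} (α : Fin m → List (Fin n)) : Prop :=
  ∀ χ : Cantor n, ∃! i : Fin m, PrefixOf (α i) χ

/-- The group structure on self-homeomorphisms of a topological space,
with `f * g` acting as `g` followed by `f`. -/
instance homeoGroup {X : Type*} [TopologicalSpace X] : Group (X ≃ₜ X) where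
  mul f g := g.trans f
  one := Homeomorph.refl X
  inv := Homeomorph.symm
  mul_assoc a b c := Homeomorph.ext fun _ => rfl
  one_mul a := Homeomorph.ext fun _ => rfl
  mul_one a := Homeomorph.ext fun _ => rfl
  inv_mul_cancel a := Homeomorph.ext fun x => a.symm_apply_apply x

/-- The Higman–Thompson group `Vₙ`, as the set of self-homeomorphisms of Cantor space
which act by exchanging finite prefixes along a pair of maximal antichains. -/
def Vn (n : ℕ) : Set (Cantor n ≃ₜ Cantor n) :=
  {g | ∃ (m : ℕ) (α β : Fin m → List (Fin n)), AntichainFam α ∧ AntichainFam β ∧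
      ∀ (i : Fin m) (χ : Cantor n), g (appendInf (α i) χ) = appendInf (β i) χ}

/-- Conjugation in the paper's right-action convention: `paperConj g v = g⁻¹ v g`,
i.e. the homeomorphism `x ↦ (x) g⁻¹ v g` (first apply `g⁻¹`, then `v`, then `g`). -/
def paperConj {n : ℕ} (g v : Cantor n ≃ₜ Cantor n) : Cantor n ≃ₜ Cantor n :=
  (g.symm.trans v).trans g

/-- `l` is the longest common prefix of the set `A` of infinite words. -/
def IsLCP {n : ℕ} (A : Set (Cantor n)) (l : List (Fin n)) : Prop :=
  (∀ ρ ∈ A, PrefixOf l ρ) ∧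
    ∀ l' : List (Fin n), (∀ ρ ∈ A, PrefixOf l' ρ) → l'.length ≤ l.length

/-- A (not necessarily finite-state) transducer over the alphabet `Fin n`. -/
structure Transducer (n : ℕ) where
  /-- the set of states -/
  Q : Type
  /-- the transition function -/
  tr : Fin n → Q → Q
  /-- the output (rewrite) function -/
  out : Fin n → Q → List (Fin n)

namespace Transducer

variable {n : ℕ}

/-- The transition function extended to finite words. -/
def transStar (T : Transducer n) : List (Fin n) → T.Q → T.Q
  | [], q => q
  | x :: w, q => T.transStar w (T.tr x q)

/-- The output function extended to finite words. -/
def outStar (T : Transducer n) : List (Fin n) → T.Q → List (Fin n)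
  | [], _ => []
  | x :: w, q => T.out x q ++ T.outStar w (T.tr x q)

/-- The initial transducer `T_q` induces the map `f` on Cantor space: the outputs along
ever longer prefixes of `χ` are ever longer prefixes of `f χ`. -/
def Induces (T : Transducer n) (q : T.Q) (f : Cantor n → Cantor n) : Prop :=
  ∀ (χ : Cantor n) (m : ℕ), ∃ k : ℕ,
    m ≤ (T.outStar (takeW χ k) q).length ∧ PrefixOf (T.outStar (takeW χ k) q) (f χ)

/-- The image of the state `q`: the image of Cantor space under the map induced by `T_q`. -/
def stateImage (T : Transducer n) (q : T.Q) : Set (Cantor n) :=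
  {y | ∃ (f : Cantor n → Cantor n) (χ : Cantor n), T.Induces q f ∧ f χ = y}

/-- `T` is synchronizing at level `k`: the state reached after reading any word of
length `k` does not depend on the starting state. -/
def SyncAtLevel (T : Transducer n) (k : ℕ) : Prop :=
  ∀ w : List (Fin n), w.length = k → ∀ q q' : T.Q, T.transStar w q = T.transStar w q'

/-- `T` is synchronizing if it is synchronizing at some level. -/
def Synchronizing (T : Transducer n) : Prop := ∃ k, T.SyncAtLevel k

/-- `T` (inducing the homeomorphism `h` at `q0`) is one-way synchronizing: `T` is
synchronizing, but the inverse homeomorphism is not induced by any finite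
synchronizing transducer (equivalently, the inverse transducer is not synchronizing). -/
def OneWaySync (T : Transducer n) (q0 : T.Q) (h : Cantor n ≃ₜ Cantor n) : Prop :=
  T.Induces q0 ⇑h ∧ T.Synchronizing ∧
    ¬ ∃ (S : Transducer n) (_ : Finite S.Q) (s0 : S.Q),
        S.Induces s0 ⇑h.symm ∧ S.Synchronizing

/-- `T` is equal to its core : every state is reached by reading a word of length `k`
from some state, for every synchronizing level `k`. -/
def EqualToCore (T : Transducer n) : Prop :=
  ∀ k : ℕ, T.SyncAtLevel k → ∀ q : T.Q, ∃ (w : List (Fin n)) (p : T.Q),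
    w.length = k ∧ T.transStar w p = q

/-- Every state of `T` is accessible from `q0`. -/
def Accessible (T : Transducer n) (q0 : T.Q) : Prop :=
  ∀ q : T.Q, ∃ w : List (Fin n), T.transStar w q0 = q

/-- The product transducer `T S` (first act by `T`, then by `S`). -/
def prod (T S : Transducer n) : Transducer n where
  Q := T.Q × S.Q
  tr := fun x p => (T.tr x p.1, S.transStar (T.out x p.1) p.2)
  out := fun x p => S.outStar (T.out x p.1) p.2

/-- `T` is partially invertible: every state induces an injective map on Cantor space
with clopen image. -/
def PartiallyInvertible (T : Transducer n) : Prop :=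
  ∀ q : T.Q, ∃ f : Cantor n → Cantor n,
    T.Induces q f ∧ Function.Injective f ∧ IsClopen (Set.range f)

/-- `T` has no states of incomplete response: for each state `q` and letter `i`, no word
strictly longer than `λ(i,q)` is a common prefix of the outputs on all of the cone `[i]`. -/
def NoIncompleteResponse (T : Transducer n) : Prop :=
  ∀ (q : T.Q) (i x : Fin n),
    ¬ ∀ χ : Cantor n, ∃ k : ℕ, (T.out i q ++ [x]) <+: T.outStar (i :: takeW χ k) q

/-- States `q` of `T` and `p` of `S` are `ω`-equivalent: they induce one and the same
map on Cantor space. -/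
def OmegaEq (T : Transducer n) (q : T.Q) (S : Transducer n) (p : S.Q) : Prop :=
  ∃ f : Cantor n → Cantor n, T.Induces q f ∧ S.Induces p f

/-- `T` is minimal: no states of incomplete response and no pair of distinct
`ω`-equivalent states. -/
def Minimal (T : Transducer n) : Prop :=
  T.NoIncompleteResponse ∧ ∀ q q' : T.Q, T.OmegaEq q T q' → q = q'

/-- The map on Cantor space induced by the state `q` (junk value if none exists). -/
def inducedMap (T : Transducer n) (q : T.Q) : Cantor n → Cantor n :=
  if h : ∃ f, T.Induces q f then h.choose else id

/-- `𝓛_q(α)`: the longest common prefix of the preimage of the cone `[α]` under `T_q`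
(junk value if it does not exist). -/
def lcp (T : Transducer n) (q : T.Q) (α : List (Fin n)) : List (Fin n) :=
  if h : ∃ l, IsLCP {ρ : Cantor n | T.inducedMap q ρ ∈ cone α} l then h.choose else []

/-- The inverse transducer of `T` given by the inversion algorithm, on the set of all
pairs `(w, q)`: reading `x` from `(w,q)` outputs `𝓛_q(wx)` and moves to
`(wx - λ(𝓛_q(wx), q), π(𝓛_q(wx), q))`. -/
def invT (T : Transducer n) : Transducer n where
  Q := List (Fin n) × T.Q
  tr := fun x p =>
    ((p.1 ++ [x]).drop (T.outStar (T.lcp p.2 (p.1 ++ [x])) p.2).length,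
      T.transStar (T.lcp p.2 (p.1 ++ [x])) p.2)
  out := fun x p => T.lcp p.2 (p.1 ++ [x])

/-- Restriction of a transducer to a set of states (transitions leaving the set are
replaced by junk loops; for transition-closed sets this is the honest restriction). -/
def restrictTo (T : Transducer n) (P : T.Q → Prop) : Transducer n where
  Q := {q : T.Q // P q}
  tr := fun x q => if h : P (T.tr x q.1) then ⟨T.tr x q.1, h⟩ else q
  out := fun x q => T.out x q.1

/-- The set of states reachable from `q0`. -/
def reach (T : Transducer n) (q0 : T.Q) : T.Q → Prop :=
  fun q => ∃ w : List (Fin n), T.transStar w q0 = q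

/-- The inverse transducer of the initial transducer `T_{q0}`, with state set the states
accessible from `(ε, q0)`. -/
def invAcc (T : Transducer n) (q0 : T.Q) : Transducer n :=
  (T.invT).restrictTo ((T.invT).reach ([], q0))

/-- A pair `(w,p)` is good if `[w] ⊆ im(T_p)` and `𝓛_p(w) = ε`. -/
def GoodPair (T : Transducer n) (p : List (Fin n) × T.Q) : Prop :=
  cone p.1 ⊆ T.stateImage p.2 ∧
    IsLCP {ρ : Cantor n | T.inducedMap p.2 ρ ∈ cone p.1} []

/-- The partial inverse `T'` of a partially invertible transducer `T`: the inverse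
transducer restricted to the good pairs `(w,p)` with `[w] ⊆ im(T_p)`, `𝓛_p(w) = ε`. -/
def partialInv (T : Transducer n) : Transducer n :=
  (T.invT).restrictTo T.GoodPair

/-- `h` is a completion of `T`: there are a maximal antichain `η` and an effective viable
combination `(ρ, p)` such that `h` maps `η_i χ` to `ρ_i (χ)T_{p_i}`. -/
def IsCompletion (T : Transducer n) (h : Cantor n ≃ₜ Cantor n) : Prop :=
  ∃ (l : ℕ) (η ρ : Fin l → List (Fin n)) (p : Fin l → T.Q)
      (f : Fin l → (Cantor n → Cantor n)),
    l % (n - 1) = 1 % (n - 1) ∧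
    AntichainFam η ∧
    (∀ i, T.Induces (p i) (f i)) ∧
    (⋃ i, appendInf (ρ i) '' Set.range (f i)) = Set.univ ∧
    (∀ i j, i ≠ j →
      Disjoint (appendInf (ρ i) '' Set.range (f i))
        (appendInf (ρ j) '' Set.range (f j))) ∧
    ∀ (i : Fin l) (χ : Cantor n), h (appendInf (η i) χ) = appendInf (ρ i) (f i χ)

/-- The group `𝓗(T)` generated by all completions of `T`. -/
def HGroup (T : Transducer n) : Subgroup (Cantor n ≃ₜ Cantor n) :=
  Subgroup.closure {h | T.IsCompletion h}

/-- The subgroup-generating equivalence relation induced by the automaton underlying a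
transducer `A` with start state `a0` (by Lemma 4.1, two words are related iff the states
they reach are identified by the collapsing procedure, i.e. iff the reached states
transition identically on all sufficiently long words). -/
def simA (A : Transducer n) (a0 : A.Q) (α β : List (Fin n)) : Prop :=
  ∃ i : ℕ, ∀ w : List (Fin n), w.length = i →
    A.transStar w (A.transStar α a0) = A.transStar w (A.transStar β a0)

/-- `if b then T else T'`. -/
def factor (T : Transducer n) (b : Bool) : Transducer n :=
  if b then T else T.partialInv

/-- The product of a nonempty list of factors, each equal to `T` or its partial
inverse `T'`; these products make up the set `Π(T)`. -/
def prodOf (T : Transducer n) : List Bool → Transducer n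
  | [] => T
  | [b] => T.factor b
  | b :: c :: rest => (T.factor b).prod (T.prodOf (c :: rest))

/-- `T` is contracting: every state of every product of copies of `T` and `T'` is
`ω`-equivalent to an initial transducer which, after reading some fixed length of input,
always acts as a state of `T`. -/
def Contracting (T : Transducer n) : Prop :=
  ∀ L : List Bool, L ≠ [] → ∀ q : (T.prodOf L).Q,
    ∃ (V : Transducer n) (p : V.Q) (f : Cantor n → Cantor n),
      (T.prodOf L).Induces q f ∧ V.Induces p f ∧
      ∃ j : ℕ, ∀ w : List (Fin n), w.length = j →
        ∃ (u : T.Q) (g : Cantor n → Cantor n),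
          V.Induces (V.transStar w p) g ∧ T.Induces u g

end Transducer

/-- The element `v` of `Vₙ` preserves the relation `r` on nonempty finite words:
whenever `v` replaces the prefix `α` by `β`, the words `α` and `β` are related. -/
def PreservesRel {n : ℕ} (r : List (Fin n) → List (Fin n) → Prop)
    (g : Cantor n ≃ₜ Cantor n) : Prop :=
  ∀ (α β : List (Fin n)), α ≠ [] → β ≠ [] →
    (∀ χ : Cantor n, g (appendInf α χ) = appendInf β χ) → r α β

/-- The subgroup `V_∼` of `Vₙ` generated by the prefix-exchange homeomorphisms
preserving the relation `r`. -/
def VSim (n : ℕ) (r : List (Fin n) → List (Fin n) → Prop) :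
    Subgroup (Cantor n ≃ₜ Cantor n) :=
  Subgroup.closure {g | g ∈ Vn n ∧ PreservesRel r g}

/-- `f` coincides with `g` on the cone `[α]` (conjugated into the cone) and is the
identity off the cone: the homeomorphism `[α]_g`. -/
def IsRestrTo {n : ℕ} (α : List (Fin n)) (g f : Cantor n ≃ₜ Cantor n) : Prop :=
  (∀ χ : Cantor n, f (appendInf α χ) = appendInf α (g χ)) ∧
  ∀ χ : Cantor n, ¬ PrefixOf α χ → f χ = χ

/-- The Nekrashevych group `Vₙ(G)`: the group generated by `Vₙ` together with all the
homeomorphisms `[α]_g` for `g ∈ G`. -/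
def NekG (n : ℕ) (G : Subgroup (Cantor n ≃ₜ Cantor n)) :
    Subgroup (Cantor n ≃ₜ Cantor n) :=
  Subgroup.closure (Vn n ∪ {f | ∃ (α : List (Fin n)) (g : Cantor n ≃ₜ Cantor n),
    g ∈ G ∧ IsRestrTo α g f})

/-- The homeomorphism `f` locally agrees with the set `G` of homeomorphisms. -/
def LocallyAgrees {n : ℕ} (G : Set (Cantor n ≃ₜ Cantor n))
    (f : Cantor n ≃ₜ Cantor n) : Prop :=
  ∀ x : Cantor n, ∃ U : Set (Cantor n), IsOpen U ∧ x ∈ U ∧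
    ∃ g ∈ G, Set.EqOn ⇑f ⇑g U

/-- A finite synchronous invertible transducer over `Fin n`: each state rewrites single
letters to single letters bijectively. -/
structure SyncTransducer (n : ℕ) where
  /-- the set of states -/
  Q : Type
  /-- there are finitely many states -/
  fin : Finite Q
  /-- the transition function -/
  tr : Fin n → Q → Q
  /-- the (single-letter) output function -/
  out : Fin n → Q → Fin n
  /-- each state rewrites letters bijectively -/
  bij : ∀ q : Q, Function.Bijective fun x => out x q

namespace SyncTransducer

variable {n : ℕ}

/-- The transition function extended to finite words. -/
def trStar (U : SyncTransducer n) : List (Fin n) → U.Q → U.Q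
  | [], q => q
  | x :: w, q => U.trStar w (U.tr x q)

/-- The output function extended to finite words. -/
def outWord (U : SyncTransducer n) : List (Fin n) → U.Q → List (Fin n)
  | [], _ => []
  | x :: w, q => U.out x q :: U.outWord w (U.tr x q)

/-- The map on Cantor space induced by the initial transducer `U_q`. -/
def applyFun (U : SyncTransducer n) (q : U.Q) (χ : Cantor n) : Cantor n :=
  fun i => U.out (χ i) (U.trStar (takeW χ i) q)

/-- The inverse transducer of a synchronous invertible transducer. -/
def inv (U : SyncTransducer n) : SyncTransducer n where
  Q := U.Q
  fin := U.fin
  tr := fun y q => U.tr ((Equiv.ofBijective _ (U.bij q)).symm y) q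
  out := fun y q => (Equiv.ofBijective _ (U.bij q)).symm y
  bij := fun q => (Equiv.ofBijective _ (U.bij q)).symm.bijective

/-- The product of synchronous transducers (first act by `T`, then by `S`). -/
def sprod (T S : SyncTransducer n) : SyncTransducer n where
  Q := T.Q × S.Q
  fin := by
    haveI := T.fin; haveI := S.fin
    infer_instance
  tr := fun x p => (T.tr x p.1, S.tr (T.out x p.1) p.2)
  out := fun x p => S.out (T.out x p.1) p.2
  bij := fun p => (S.bij p.2).comp (T.bij p.1)

/-- `U` is synchronizing at level `k`. -/
def SyncAtLevel (U : SyncTransducer n) (k : ℕ) : Prop :=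
  ∀ w : List (Fin n), w.length = k → ∀ q q' : U.Q, U.trStar w q = U.trStar w q'

/-- `U` is synchronizing. -/
def Synchronizing (U : SyncTransducer n) : Prop := ∃ k, U.SyncAtLevel k

/-- `U` is minimal (under `ω`-equivalence): distinct states induce distinct maps. -/
def Minimal (U : SyncTransducer n) : Prop :=
  ∀ q q' : U.Q, U.applyFun q = U.applyFun q' → q = q'

/-- One-way synchronizing: `U` is synchronizing but the inverse homeomorphism of
`h = U_{q0}` is not induced by any finite synchronizing transducer. -/
def OneWaySync (U : SyncTransducer n) (h : Cantor n ≃ₜ Cantor n) : Prop :=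
  U.Synchronizing ∧
    ¬ ∃ (S : Transducer n) (_ : Finite S.Q) (s0 : S.Q),
        S.Induces s0 ⇑h.symm ∧ S.Synchronizing

/-- `U` is equal to its core. -/
def EqualToCore (U : SyncTransducer n) : Prop :=
  ∀ k : ℕ, U.SyncAtLevel k → ∀ q : U.Q, ∃ (w : List (Fin n)) (p : U.Q),
    w.length = k ∧ U.trStar w p = q

/-- The underlying (asynchronous-format) transducer of a synchronous transducer. -/
def toT (U : SyncTransducer n) : Transducer n :=
  ⟨U.Q, U.tr, fun x q => [U.out x q]⟩

/-- The automaton group `𝒢(U)` generated by `U`: the subgroup of the homeomorphism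
group of Cantor space generated by the homeomorphisms `U_q` for the states `q`. -/
def autG (U : SyncTransducer n) : Subgroup (Cantor n ≃ₜ Cantor n) :=
  Subgroup.closure {f : Cantor n ≃ₜ Cantor n | ∃ q : U.Q, ⇑f = U.applyFun q}

end SyncTransducer

section Words

variable {n : ℕ}

@[simp] lemma appendInf_nil (χ : Cantor n) : appendInf [] χ = χ := by
  funext i; simp [appendInf]

lemma appendInf_append (a b : List (Fin n)) (χ : Cantor n) :
    appendInf (a ++ b) χ = appendInf a (appendInf b χ) := by
  funext i
  simp only [appendInf, List.length_append, List.get_eq_getElem]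
  by_cases h1 : i < a.length
  · have h2 : i < a.length + b.length := by omega
    simp [h1, h2]
  · by_cases h2 : i < a.length + b.length
    · have h3 : i - a.length < b.length := by omega
      simp [h1, h2, h3, List.getElem_append_right (not_lt.mp h1)]
    · have h3 : ¬ i - a.length < b.length := by omega
      simp [h1, h2, h3, Nat.sub_sub]

lemma appendInf_injective (w : List (Fin n)) : Function.Injective (appendInf w) := by
  intro χ χ' h
  funext i
  simpa [appendInf] using congrFun h (w.length + i)

lemma prefixOf_appendInf (w : List (Fin n)) (χ : Cantor n) : PrefixOf w (appendInf w χ) := by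
  intro i h
  simp [appendInf, h]

lemma PrefixOf.exists_eq {w : List (Fin n)} {χ : Cantor n} (h : PrefixOf w χ) :
    ∃ χ', χ = appendInf w χ' := by
  refine ⟨fun i => χ (w.length + i), ?_⟩
  funext i
  by_cases hi : i < w.length
  · simpa [appendInf, hi] using (h i hi).symm
  · simp only [appendInf, hi, dite_false]
    congr 1
    omega

lemma prefixOf_append_iff {a b : List (Fin n)} {χ : Cantor n} :
    PrefixOf (a ++ b) (appendInf a χ) ↔ PrefixOf b χ := by
  constructor
  · intro h
    obtain ⟨χ', h'⟩ := h.exists_eq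
    rw [appendInf_append] at h'
    rw [appendInf_injective a h']
    exact prefixOf_appendInf _ _
  · intro h
    obtain ⟨χ', rfl⟩ := h.exists_eq
    rw [← appendInf_append]
    exact prefixOf_appendInf _ _

lemma PrefixOf.of_prefix {a b : List (Fin n)} {χ : Cantor n} (hab : a <+: b)
    (h : PrefixOf b χ) : PrefixOf a χ := by
  obtain ⟨c, rfl⟩ := hab
  obtain ⟨χ', rfl⟩ := h.exists_eq
  rw [appendInf_append]
  exact prefixOf_appendInf _ _

lemma PrefixOf.prefix_of_length_le {a b : List (Fin n)} {χ : Cantor n} (ha : PrefixOf a χ)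
    (hb : PrefixOf b χ) (hl : a.length ≤ b.length) : a <+: b := by
  rw [List.prefix_iff_eq_take]
  apply List.ext_getElem
  · simp [hl]
  · intro i h1 h2
    have := (ha i h1).trans (hb i (by omega)).symm
    simpa using this

@[simp] lemma length_takeW (χ : Cantor n) (k : ℕ) : (takeW χ k).length = k := by
  simp [takeW]

lemma prefixOf_takeW (χ : Cantor n) (k : ℕ) : PrefixOf (takeW χ k) χ := by
  intro i h
  simp [takeW]

lemma PrefixOf.eq_takeW {w : List (Fin n)} {χ : Cantor n} (h : PrefixOf w χ) :
    w = takeW χ w.length :=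
  (h.prefix_of_length_le (prefixOf_takeW χ _) (by simp)).eq_of_length (by simp)

lemma takeW_prefix (χ : Cantor n) {k l : ℕ} (hkl : k ≤ l) : takeW χ k <+: takeW χ l :=
  (prefixOf_takeW χ k).prefix_of_length_le (prefixOf_takeW χ l) (by simpa using hkl)

lemma PrefixOf.exists_append {w : List (Fin n)} {χ : Cantor n} (h : PrefixOf w χ) (k : ℕ) :
    ∃ c, c.length = k ∧ PrefixOf (w ++ c) χ := by
  obtain ⟨χ', rfl⟩ := h.exists_eq
  exact ⟨takeW χ' k, by simp, prefixOf_append_iff.2 (prefixOf_takeW _ _)⟩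

lemma eq_nil_of_forall_prefixOf (hn : 2 ≤ n) {c : List (Fin n)}
    (h : ∀ χ : Cantor n, PrefixOf c χ) : c = [] := by
  cases c with
  | nil => rfl
  | cons y c =>
    have : Nontrivial (Fin n) := Fin.nontrivial_iff_two_le.2 hn
    obtain ⟨z, hz⟩ := exists_ne y
    exact absurd (h (fun _ => z) 0 (by simp)) (by simpa using hz.symm)

/-- A word that begins every element of a cone begins the word defining that cone. -/
lemma prefix_of_forall_prefixOf (hn : 2 ≤ n) {a b : List (Fin n)}
    (h : ∀ χ : Cantor n, PrefixOf a (appendInf b χ)) : a <+: b := by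
  have : NeZero n := ⟨by omega⟩
  rcases le_total a.length b.length with hl | hl
  · exact (h (fun _ => 0)).prefix_of_length_le (prefixOf_appendInf _ _) hl
  · obtain ⟨c, rfl⟩ := (prefixOf_appendInf b (fun _ => 0)).prefix_of_length_le (h _) hl
    have hc : c = [] := eq_nil_of_forall_prefixOf hn fun χ => prefixOf_append_iff.1 (h χ)
    simp [hc]

lemma eq_of_forall_appendInf_eq (hn : 2 ≤ n) {a b : List (Fin n)}
    (h : ∀ χ : Cantor n, appendInf a χ = appendInf b χ) : a = b := by
  have hab : a <+: b := prefix_of_forall_prefixOf hn fun χ => h χ ▸ prefixOf_appendInf a χ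
  have hba : b <+: a := prefix_of_forall_prefixOf hn fun χ => h χ ▸ prefixOf_appendInf b χ
  exact hab.eq_of_length_le hba.length_le

end Words

section Topology

variable {n : ℕ}

lemma isOpen_cone (w : List (Fin n)) : IsOpen (cone w) := by
  have : cone w = ⋂ i : Fin w.length, (fun χ : Cantor n => χ i) ⁻¹' {w.get i} := by
    ext χ
    simp only [cone, PrefixOf, Set.mem_ofPred_eq, Set.mem_iInter, Set.mem_preimage,
      Set.mem_singleton_iff]
    exact ⟨fun h i => (h i i.2).symm, fun h i hi => (h ⟨i, hi⟩).symm⟩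
  rw [this]
  exact isOpen_iInter_of_finite fun i => (isOpen_discrete _).preimage (continuous_apply _)

lemma exists_cone_subset {U : Set (Cantor n)} (hU : IsOpen U) {x : Cantor n} (hx : x ∈ U) :
    ∃ k, cone (takeW x k) ⊆ U := by
  obtain ⟨I, u, hu, hIU⟩ := isOpen_pi_iff.1 hU x hx
  refine ⟨I.sup id + 1, fun χ hχ => hIU fun i hi => ?_⟩
  have hi' : i < I.sup id + 1 := Nat.lt_succ_of_le (Finset.le_sup (f := id) hi)
  have := hχ i (by simpa using hi')
  have h2 : x i = χ i := by
    simpa only [takeW, List.get_eq_getElem, List.getElem_ofFn] using this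
  exact h2 ▸ (hu i hi).2

lemma exists_prefix_cone_subset {U : Set (Cantor n)} (hU : IsOpen U) {x : Cantor n} (hx : x ∈ U)
    {a : List (Fin n)} (ha : PrefixOf a x) :
    ∃ c, PrefixOf (a ++ c) x ∧ ∀ χ, appendInf (a ++ c) χ ∈ U := by
  obtain ⟨k, hk⟩ := exists_cone_subset hU hx
  obtain ⟨c, hc, hp⟩ := PrefixOf.exists_append ha k
  refine ⟨c, hp, fun χ => hk ?_⟩
  have : takeW x k <+: a ++ c :=
    (prefixOf_takeW x k).prefix_of_length_le hp (by simp [hc])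
  exact (prefixOf_appendInf (a ++ c) χ).of_prefix this

/-- A property of finite words that passes to extensions and holds for some prefix of every
infinite word holds for all words of some fixed length. -/
lemma exists_uniform_length (hn : 2 ≤ n) {P : List (Fin n) → Prop}
    (hmono : ∀ a c, P a → P (a ++ c)) (hP : ∀ x : Cantor n, ∃ a, PrefixOf a x ∧ P a) :
    ∃ N, ∀ a : List (Fin n), N ≤ a.length → P a := by
  have : NeZero n := ⟨by omega⟩
  choose a ha hPa using hP
  obtain ⟨t, ht⟩ := isCompact_univ.elim_finite_subcover (fun x : Cantor n => cone (a x))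
    (fun x => isOpen_cone _) fun x _ => Set.mem_iUnion.2 ⟨x, ha x⟩
  refine ⟨t.sup fun x => (a x).length, fun b hb => ?_⟩
  obtain ⟨x, hxt, hx⟩ := Set.mem_iUnion₂.1 (ht (Set.mem_univ (appendInf b fun _ => 0)))
  have hle : (a x).length ≤ b.length :=
    (Finset.le_sup (f := fun x => (a x).length) hxt).trans hb
  obtain ⟨c, rfl⟩ := PrefixOf.prefix_of_length_le hx (prefixOf_appendInf _ _) hle
  exact hmono _ _ (hPa x)

lemma Continuous.exists_prefix_length (hn : 2 ≤ n) {f : Cantor n → Cantor n} (hf : Continuous f)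
    (N : ℕ) : ∃ M, ∀ a : List (Fin n), M ≤ a.length →
      ∃ b : List (Fin n), b.length = N ∧ ∀ χ, PrefixOf b (f (appendInf a χ)) := by
  refine exists_uniform_length hn ?_ ?_
  · rintro a c ⟨b, hb, h⟩
    exact ⟨b, hb, fun χ => by rw [appendInf_append]; exact h _⟩
  · intro x
    obtain ⟨k, hk⟩ := exists_cone_subset ((isOpen_cone (takeW (f x) N)).preimage hf)
      (x := x) (prefixOf_takeW _ _)
    exact ⟨takeW x k, prefixOf_takeW _ _, takeW (f x) N, by simp,
      fun χ => hk (prefixOf_appendInf _ _)⟩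

end Topology

section Thompson

variable {n : ℕ}

/-- `g` replaces the prefix `a` by the prefix `b`. -/
def ExchangesPrefix (g : Cantor n ≃ₜ Cantor n) (a b : List (Fin n)) : Prop :=
  ∀ χ, g (appendInf a χ) = appendInf b χ

lemma ExchangesPrefix.append {g : Cantor n ≃ₜ Cantor n} {a b : List (Fin n)}
    (h : ExchangesPrefix g a b) (c : List (Fin n)) : ExchangesPrefix g (a ++ c) (b ++ c) := by
  intro χ
  rw [appendInf_append, appendInf_append]
  exact h _

lemma ExchangesPrefix.symm {g : Cantor n ≃ₜ Cantor n} {a b : List (Fin n)}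
    (h : ExchangesPrefix g a b) : ExchangesPrefix g.symm b a := fun χ => by
  rw [← h χ, Homeomorph.symm_apply_apply]

lemma ExchangesPrefix.prefixOf {g : Cantor n ≃ₜ Cantor n} {a b : List (Fin n)}
    (h : ExchangesPrefix g a b) {x : Cantor n} (hx : PrefixOf a x) : PrefixOf b (g x) := by
  obtain ⟨χ, rfl⟩ := hx.exists_eq
  rw [h χ]
  exact prefixOf_appendInf _ _

lemma ExchangesPrefix.prefixOf_iff {g : Cantor n ≃ₜ Cantor n} {a b : List (Fin n)}
    (h : ExchangesPrefix g a b) {x : Cantor n} : PrefixOf b (g x) ↔ PrefixOf a x :=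
  ⟨fun hx => by simpa using h.symm.prefixOf hx, h.prefixOf⟩

lemma exists_exchangesPrefix_of_mem_Vn {g : Cantor n ≃ₜ Cantor n} (hg : g ∈ Vn n)
    (x : Cantor n) : ∃ a b, PrefixOf a x ∧ ExchangesPrefix g a b := by
  obtain ⟨m, α, β, hα, -, h⟩ := hg
  obtain ⟨i, hi, -⟩ := hα x
  exact ⟨α i, β i, hi, h i⟩

/-- `Vₙ` consists of the homeomorphisms that locally exchange prefixes. -/
lemma mem_Vn_iff (hn : 2 ≤ n) {g : Cantor n ≃ₜ Cantor n} :
    g ∈ Vn n ↔ ∀ x, ∃ a b, PrefixOf a x ∧ ExchangesPrefix g a b := by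
  refine ⟨exists_exchangesPrefix_of_mem_Vn, fun h => ?_⟩
  obtain ⟨N, hN⟩ := exists_uniform_length hn (P := fun a => ∃ b, ExchangesPrefix g a b)
    (fun a c ⟨b, hb⟩ => ⟨b ++ c, hb.append c⟩)
    (fun x => by obtain ⟨a, b, ha, hb⟩ := h x; exact ⟨a, ha, b, hb⟩)
  let e : Fin (Fintype.card (Fin N → Fin n)) ≃ (Fin N → Fin n) := (Fintype.equivFin _).symm
  choose β hβ using fun i => hN (List.ofFn (e i)) (by simp)
  have hα : AntichainFam fun i => List.ofFn (e i) := by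
    intro χ
    refine ⟨e.symm fun i => χ i, ?_, ?_⟩
    · simpa [takeW] using prefixOf_takeW χ N
    · intro j hj
      have : List.ofFn (e j) = takeW χ N := by simpa using PrefixOf.eq_takeW hj
      rw [Equiv.eq_symm_apply]
      exact List.ofFn_injective this
  refine ⟨_, _, β, hα, fun χ => ?_, hβ⟩
  have key : ∀ i, PrefixOf (β i) χ ↔ PrefixOf (List.ofFn (e i)) (g.symm χ) := fun i => by
    simpa using (hβ i).prefixOf_iff (x := g.symm χ)
  simpa only [key] using hα (g.symm χ)

/-- The conjugate `h Vₙ h⁻¹` (as maps written on the left), as a subgroup. -/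
def conjVn (hn : 2 ≤ n) (h : Cantor n ≃ₜ Cantor n) : Subgroup (Cantor n ≃ₜ Cantor n) where
  carrier := {g | paperConj h.symm g ∈ Vn n}
  mul_mem' := by
    intro f g hf hg
    simp only [Set.mem_ofPred_eq, mem_Vn_iff hn] at *
    intro x
    obtain ⟨a, b, ha, hab⟩ := hg x
    obtain ⟨c, d, hc, hcd⟩ := hf (paperConj h.symm g x)
    obtain ⟨s, hs, t, ht⟩ : ∃ s, PrefixOf (a ++ s) x ∧ c <+: b ++ s := by
      obtain ⟨s, hs, hp⟩ := PrefixOf.exists_append ha c.length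
      exact ⟨s, hp, hc.prefix_of_length_le ((hab.append s).prefixOf hp) (by simp [hs])⟩
    refine ⟨a ++ s, d ++ t, hs, fun χ => ?_⟩
    have h1 : paperConj h.symm (f * g) (appendInf (a ++ s) χ) =
        paperConj h.symm f (paperConj h.symm g (appendInf (a ++ s) χ)) := by
      change h.symm (f (g (h _))) = h.symm (f (h (h.symm (g (h _)))))
      rw [h.apply_symm_apply]
    rw [h1, hab.append s χ, ← ht, hcd.append t χ]
  one_mem' := by
    simp only [Set.mem_ofPred_eq, mem_Vn_iff hn]
    refine fun x => ⟨[], [], fun i hi => absurd hi (by simp), fun χ => ?_⟩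
    exact h.symm_apply_apply _
  inv_mem' := by
    intro g hg
    simp only [Set.mem_ofPred_eq, mem_Vn_iff hn] at *
    intro x
    obtain ⟨a, b, ha, hab⟩ := hg ((paperConj h.symm g).symm x)
    exact ⟨b, a, by simpa using hab.prefixOf ha, hab.symm⟩

lemma paperConj_image_Vn (hn : 2 ≤ n) (h : Cantor n ≃ₜ Cantor n) :
    paperConj h '' Vn n = ↑(conjVn hn h) := by
  ext g
  constructor
  · rintro ⟨v, hv, rfl⟩
    have : paperConj h.symm (paperConj h v) = v := by
      ext1 x; simp [paperConj]
    change paperConj h.symm (paperConj h v) ∈ Vn n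
    rwa [this]
  · intro hg
    exact ⟨_, hg, by ext1 x; simp [paperConj]⟩

end Thompson

section LCP

variable {n : ℕ} {A : Set (Cantor n)} {l l' : List (Fin n)}

lemma IsLCP.unique (hA : A.Nonempty) (h : IsLCP A l) (h' : IsLCP A l') : l = l' := by
  obtain ⟨ρ, hρ⟩ := hA
  have hle : l.length = l'.length := le_antisymm (h'.2 _ h.1) (h.2 _ h'.1)
  exact ((h.1 ρ hρ).prefix_of_length_le (h'.1 ρ hρ) hle.le).eq_of_length hle

lemma exists_isLCP (hA : A.Nontrivial) : ∃ l, IsLCP A l := by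
  obtain ⟨x, hx, y, hy, hxy⟩ := hA
  obtain ⟨i, hi⟩ := Function.ne_iff.1 hxy
  let P : ℕ → Prop := fun k => ∃ l : List (Fin n), (∀ ρ ∈ A, PrefixOf l ρ) ∧ l.length = k
  have hbound : ∀ l : List (Fin n), (∀ ρ ∈ A, PrefixOf l ρ) → l.length ≤ i := by
    intro l hl
    by_contra! hlt
    exact hi ((hl x hx i hlt).symm.trans (hl y hy i hlt))
  have hP0 : P 0 := ⟨[], fun ρ _ i h => absurd h (by simp), rfl⟩
  obtain ⟨l, hl, hlen⟩ := Nat.findGreatest_spec (Nat.zero_le i) hP0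
  exact ⟨l, hl, fun l' hl' => hlen ▸ Nat.le_findGreatest (hbound l' hl') ⟨l', hl', rfl⟩⟩

lemma isLCP_append_iff (hA : A.Nonempty) {a : List (Fin n)} (ha : ∀ ρ ∈ A, PrefixOf a ρ) :
    IsLCP A (a ++ l) ↔ IsLCP {ρ | appendInf a ρ ∈ A} l := by
  constructor
  · rintro ⟨h1, h2⟩
    refine ⟨fun ρ hρ => prefixOf_append_iff.1 (h1 _ hρ), fun l' hl' => ?_⟩
    have := h2 (a ++ l') fun ρ hρ => by
      obtain ⟨ρ, rfl⟩ := (ha ρ hρ).exists_eq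
      exact prefixOf_append_iff.2 (hl' ρ hρ)
    simpa using this
  · rintro ⟨h1, h2⟩
    refine ⟨fun ρ hρ => ?_, fun l' hl' => ?_⟩
    · obtain ⟨ρ, rfl⟩ := (ha ρ hρ).exists_eq
      exact prefixOf_append_iff.2 (h1 ρ hρ)
    · rcases le_total l'.length a.length with hle | hle
      · simp; omega
      · obtain ⟨ρ, hρ⟩ := hA
        obtain ⟨c, rfl⟩ := (ha ρ hρ).prefix_of_length_le (hl' ρ hρ) hle
        have := h2 c fun ρ hρ => prefixOf_append_iff.1 (hl' _ hρ)
        simpa using this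

end LCP

namespace Transducer

variable {n : ℕ} {T : Transducer n} {q : T.Q} {f : Cantor n → Cantor n}

lemma transStar_append (a b : List (Fin n)) (q : T.Q) :
    T.transStar (a ++ b) q = T.transStar b (T.transStar a q) := by
  induction a generalizing q with
  | nil => rfl
  | cons x a ih => exact ih _

lemma outStar_append (a b : List (Fin n)) (q : T.Q) :
    T.outStar (a ++ b) q = T.outStar a q ++ T.outStar b (T.transStar a q) := by
  induction a generalizing q with
  | nil => rfl
  | cons x a ih => simp [outStar, transStar, ih]

lemma outStar_prefix {a b : List (Fin n)} (hab : a <+: b) (q : T.Q) :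
    T.outStar a q <+: T.outStar b q := by
  obtain ⟨c, rfl⟩ := hab
  exact ⟨_, (outStar_append a c q).symm⟩

lemma Induces.prefixOf (hf : T.Induces q f) {w : List (Fin n)} {χ : Cantor n}
    (hw : PrefixOf w χ) : PrefixOf (T.outStar w q) (f χ) := by
  obtain ⟨k, hk, hp⟩ := hf χ (T.outStar w q).length
  rw [hw.eq_takeW] at hk ⊢
  rcases le_total w.length k with hle | hle
  · exact hp.of_prefix (outStar_prefix (takeW_prefix χ hle) q)
  · rw [← (outStar_prefix (takeW_prefix χ hle) q).eq_of_length_le hk]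
    exact hp

lemma Induces.unique {f' : Cantor n → Cantor n} (hf : T.Induces q f) (hf' : T.Induces q f') :
    f = f' := by
  funext χ i
  obtain ⟨k, hk, hp⟩ := hf χ (i + 1)
  exact (hp i hk).symm.trans (hf'.prefixOf (prefixOf_takeW χ k) i hk)

lemma Induces.inducedMap_eq (hf : T.Induces q f) : T.inducedMap q = f := by
  have h : ∃ f, T.Induces q f := ⟨f, hf⟩
  rw [inducedMap, dif_pos h]
  exact h.choose_spec.unique hf

lemma Induces.residual (hf : T.Induces q f) (w : List (Fin n)) :
    T.Induces (T.transStar w q) (T.inducedMap (T.transStar w q)) ∧ ∀ χ, f (appendInf w χ) =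
      appendInf (T.outStar w q) (T.inducedMap (T.transStar w q) χ) := by
  choose f' hf' using fun χ => (hf.prefixOf (prefixOf_appendInf w χ)).exists_eq
  have hind : T.Induces (T.transStar w q) f' := by
    intro χ m
    obtain ⟨k, hk, -⟩ := hf (appendInf w χ) ((T.outStar w q).length + m)
    have hpre : takeW (appendInf w χ) k <+: w ++ takeW χ k :=
      (prefixOf_takeW _ _).prefix_of_length_le
        (prefixOf_append_iff.2 (prefixOf_takeW χ k)) (by simp)
    have hle := (outStar_prefix hpre q).length_le
    have hp := hf.prefixOf (prefixOf_append_iff.2 (prefixOf_takeW χ k) : PrefixOf (w ++ _) _)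
    rw [outStar_append] at hle hp
    rw [List.length_append] at hle
    refine ⟨k, by omega, ?_⟩
    rw [hf' χ] at hp
    exact prefixOf_append_iff.1 hp
  rw [hind.inducedMap_eq]
  exact ⟨hind, hf'⟩

lemma lcp_spec (hf : T.Induces q f) {w : List (Fin n)}
    (h : ∃ l, IsLCP {ρ | PrefixOf w (f ρ)} l) :
    IsLCP {ρ | PrefixOf w (f ρ)} (T.lcp q w) := by
  have h' : ∃ l, IsLCP {ρ : Cantor n | T.inducedMap q ρ ∈ cone w} l := by
    rw [hf.inducedMap_eq]; exact h
  have := h'.choose_spec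
  rw [lcp, dif_pos h']
  simp only [hf.inducedMap_eq] at this ⊢
  exact this

lemma transStar_restrictTo_val {P : T.Q → Prop} (hP : ∀ x q, P q → P (T.tr x q))
    (w : List (Fin n)) (q : (T.restrictTo P).Q) :
    ((T.restrictTo P).transStar w q).1 = T.transStar w q.1 := by
  induction w generalizing q with
  | nil => rfl
  | cons x w ih =>
    refine (ih _).trans ?_
    simp [restrictTo, transStar, hP x q.1 q.2]

lemma invAcc_transStar_val (q0 : T.Q) (w : List (Fin n)) (q : (T.invAcc q0).Q) :
    ((T.invAcc q0).transStar w q).1 = T.invT.transStar w q.1 := by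
  refine transStar_restrictTo_val ?_ w q
  rintro x q ⟨w, rfl⟩
  exact ⟨w ++ [x], transStar_append w [x] _⟩

/-- The state of the inverse transducer after reading `u` from `(ε, q0)`. -/
def invState (T : Transducer n) (q0 : T.Q) (u : List (Fin n)) : List (Fin n) × T.Q :=
  T.invT.transStar u ([], q0)

lemma invState_append_singleton (q0 : T.Q) (u : List (Fin n)) (x : Fin n) :
    T.invState q0 (u ++ [x]) = T.invT.tr x (T.invState q0 u) :=
  transStar_append (T := T.invT) u [x] _

lemma simA_invAcc_iff (q0 : T.Q) (α β : List (Fin n)) :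
    (T.invAcc q0).simA ⟨([], q0), ⟨[], rfl⟩⟩ α β ↔
      ∃ i : ℕ, ∀ w : List (Fin n), w.length = i →
        T.invState q0 (α ++ w) = T.invState q0 (β ++ w) := by
  have key : ∀ γ w : List (Fin n),
      ((T.invAcc q0).transStar w ((T.invAcc q0).transStar γ ⟨([], q0), ⟨[], rfl⟩⟩)).1 =
        T.invState q0 (γ ++ w) := fun γ w =>
    (congrArg Subtype.val (transStar_append γ w _).symm).trans (invAcc_transStar_val _ _ _)
  unfold simA
  refine exists_congr fun i => forall_congr' fun w => forall_congr' fun _ => ?_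
  rw [← key α w, ← key β w]
  exact Subtype.ext_iff

section Inverse

variable {q0 : T.Q} {h : Cantor n ≃ₜ Cantor n}

lemma nontrivial_preimage_cone (hn : 2 ≤ n) (h : Cantor n ≃ₜ Cantor n) (u : List (Fin n)) :
    {ρ | PrefixOf u (h ρ)}.Nontrivial := by
  have : Nontrivial (Fin n) := Fin.nontrivial_iff_two_le.2 hn
  obtain ⟨χ, χ', hne⟩ := exists_pair_ne (Cantor n)
  refine ⟨h.symm (appendInf u χ), ?_, h.symm (appendInf u χ'), ?_, fun he => hne ?_⟩
  · simpa using prefixOf_appendInf u χ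
  · simpa using prefixOf_appendInf u χ'
  · exact appendInf_injective u (h.symm.injective he)

/-- If all preimages of the cone at `u` begin with `L`, then the output on `L` begins `u`. -/
lemma outStar_prefix_of_preimage (hn : 2 ≤ n) (hind : T.Induces q0 h) {u L : List (Fin n)}
    (hL : ∀ ρ ∈ {ρ | PrefixOf u (h ρ)}, PrefixOf L ρ) : T.outStar L q0 <+: u := by
  refine prefix_of_forall_prefixOf hn fun χ => ?_
  have hmem : h.symm (appendInf u χ) ∈ {ρ | PrefixOf u (h ρ)} := by
    simpa using prefixOf_appendInf u χ
  simpa using hind.prefixOf (hL _ hmem)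

/-- The inversion algorithm, read off from the preimage of the cone at the input word. -/
lemma exists_invState (hn : 2 ≤ n) (hind : T.Induces q0 h) (u : List (Fin n)) :
    ∃ L w, IsLCP {ρ | PrefixOf u (h ρ)} L ∧ u = T.outStar L q0 ++ w ∧
      T.invState q0 u = (w, T.transStar L q0) := by
  induction u using List.reverseRecOn with
  | nil =>
    refine ⟨[], [], ⟨fun ρ _ i hi => absurd hi (by simp), fun l' hl' => ?_⟩, rfl, rfl⟩
    have : l' = [] := eq_nil_of_forall_prefixOf hn fun χ =>
      hl' χ fun i hi => absurd hi (by simp)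
    simp [this]
  | append_singleton u x ih =>
    obtain ⟨L, w, hL, hu, hs⟩ := ih
    obtain ⟨hind', hres⟩ := hind.residual L
    have hnt := nontrivial_preimage_cone hn h (u ++ [x])
    have hpre : ∀ ρ ∈ {ρ | PrefixOf (u ++ [x]) (h ρ)}, PrefixOf L ρ := fun ρ hρ =>
      hL.1 ρ (PrefixOf.of_prefix (List.prefix_append u [x]) hρ)
    have hset : {ρ | appendInf L ρ ∈ {ρ | PrefixOf (u ++ [x]) (h ρ)}} =
        {ρ | PrefixOf (w ++ [x]) (T.inducedMap (T.transStar L q0) ρ)} := by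
      ext ρ
      change PrefixOf (u ++ [x]) (h (appendInf L ρ)) ↔ PrefixOf _ _
      rw [hres, hu, List.append_assoc]
      exact prefixOf_append_iff
    have hM := lcp_spec hind' (w := w ++ [x]) (by
      obtain ⟨l, hl⟩ := exists_isLCP hnt
      obtain ⟨ρ, hρ⟩ := hnt.nonempty
      obtain ⟨M, rfl⟩ := (hpre ρ hρ).prefix_of_length_le (hl.1 ρ hρ) (hl.2 L hpre)
      rw [isLCP_append_iff hnt.nonempty hpre, hset] at hl
      exact ⟨M, hl⟩)
    set M := T.lcp (T.transStar L q0) (w ++ [x])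
    rw [← hset, ← isLCP_append_iff hnt.nonempty hpre] at hM
    obtain ⟨w', hw'⟩ := outStar_prefix_of_preimage hn hind hM.1
    refine ⟨L ++ M, w', hM, hw'.symm, ?_⟩
    have hw : w ++ [x] = T.outStar M (T.transStar L q0) ++ w' := by
      rw [hu, outStar_append, List.append_assoc, List.append_assoc] at hw'
      exact (List.append_cancel_left hw').symm
    rw [invState_append_singleton, hs]
    change (List.drop (T.outStar M (T.transStar L q0)).length (w ++ [x]),
      T.transStar M (T.transStar L q0)) = _
    rw [hw, List.drop_left, transStar_append]

/-- Elements of `Vₙ` preserving the relation of the inverse transducer are conjugates of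
elements of `Vₙ`. -/
lemma mem_conjVn_of_preservesRel (hn : 2 ≤ n) (hind : T.Induces q0 h)
    {g : Cantor n ≃ₜ Cantor n} (hg : g ∈ Vn n)
    (hrel : PreservesRel ((T.invAcc q0).simA ⟨([], q0), ⟨[], rfl⟩⟩) g) : g ∈ conjVn hn h := by
  refine (mem_Vn_iff hn).2 fun x => ?_
  obtain ⟨a, b, ha, hab⟩ := exists_exchangesPrefix_of_mem_Vn hg (h x)
  obtain ⟨c, hc, hac⟩ := PrefixOf.exists_append ha 1
  have hne : c ≠ [] := by rintro rfl; simp at hc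
  obtain ⟨i, hi⟩ := (simA_invAcc_iff q0 _ _).1
    (hrel (a ++ c) (b ++ c) (by simp [hne]) (by simp [hne]) (hab.append c))
  obtain ⟨d, hd, hacd⟩ := PrefixOf.exists_append hac i
  have hex := (hab.append c).append d
  have hstate := hi d hd
  generalize a ++ c ++ d = α at *
  generalize b ++ c ++ d = β at *
  obtain ⟨L, w, hL, hα, hs⟩ := exists_invState hn hind α
  obtain ⟨L', w', hL', hβ, hs'⟩ := exists_invState hn hind β
  rw [hs, hs', Prod.mk.injEq] at hstate
  obtain ⟨rfl, hq⟩ := hstate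
  obtain ⟨p, hp, hsub⟩ := exists_prefix_cone_subset ((isOpen_cone α).preimage h.continuous)
    (x := x) hacd (hL.1 x hacd)
  refine ⟨L ++ p, L' ++ p, hp, fun χ => ?_⟩
  have hmem : PrefixOf α (h (appendInf (L ++ p) χ)) := hsub χ
  change h.symm (g (h _)) = _
  rw [Homeomorph.symm_apply_eq]
  rw [appendInf_append, (hind.residual L).2] at hmem ⊢
  rw [hα] at hmem
  rw [appendInf_append L', (hind.residual L').2, ← hq]
  obtain ⟨χ', hχ'⟩ := (prefixOf_append_iff.1 hmem).exists_eq
  rw [hχ', ← appendInf_append, ← appendInf_append, ← hα, ← hβ]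
  exact hex χ'

/-- For synchronizing `T`, an element of `Vₙ` exchanges all sufficiently long prefixes in a way
that does not change the state of `T`. -/
lemma exists_exchangesPrefix_transStar_eq (hn : 2 ≤ n) (hsync : T.Synchronizing)
    {v : Cantor n ≃ₜ Cantor n} (hv : v ∈ Vn n) (q0 : T.Q) :
    ∃ N, ∀ a : List (Fin n), N ≤ a.length →
      ∃ b, ExchangesPrefix v a b ∧ T.transStar a q0 = T.transStar b q0 := by
  obtain ⟨k, hk⟩ := hsync
  refine exists_uniform_length hn ?_ fun x => ?_
  · rintro a c ⟨b, hab, hq⟩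
    exact ⟨b ++ c, hab.append c, by rw [transStar_append, hq, transStar_append]⟩
  · obtain ⟨a, b, ha, hab⟩ := exists_exchangesPrefix_of_mem_Vn hv x
    obtain ⟨c, hc, hac⟩ := PrefixOf.exists_append ha k
    refine ⟨a ++ c, hac, b ++ c, hab.append c, ?_⟩
    rw [transStar_append, transStar_append]
    exact hk c hc _ _

lemma paperConj_mem_Vn (hn : 2 ≤ n) (hind : T.Induces q0 h) (hsync : T.Synchronizing)
    {v : Cantor n ≃ₜ Cantor n} (hv : v ∈ Vn n) : paperConj h v ∈ Vn n := by
  obtain ⟨N, hN⟩ := exists_exchangesPrefix_transStar_eq hn hsync hv q0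
  refine (mem_Vn_iff hn).2 fun y => ?_
  obtain ⟨b, hab, hq⟩ := hN (takeW (h.symm y) N) (by simp)
  have ha := prefixOf_takeW (h.symm y) N
  generalize takeW (h.symm y) N = a at *
  have hout : PrefixOf (T.outStar a q0) y := by simpa using hind.prefixOf ha
  obtain ⟨p, hp, hsub⟩ := exists_prefix_cone_subset
    ((isOpen_cone a).preimage h.symm.continuous) (x := y) ha hout
  refine ⟨_, T.outStar b q0 ++ p, hp, fun χ => ?_⟩
  obtain ⟨ρ, hρ⟩ := PrefixOf.exists_eq (hsub χ)
  have hρ' := (Homeomorph.symm_apply_eq h).1 hρ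
  change h (v (h.symm _)) = _
  rw [(hind.residual a).2, appendInf_append] at hρ'
  rw [hρ, hab ρ, (hind.residual b).2, ← hq, ← appendInf_injective _ hρ', appendInf_append]

lemma preservesRel_paperConj (hn : 2 ≤ n) (hind : T.Induces q0 h) (hsync : T.Synchronizing)
    {v : Cantor n ≃ₜ Cantor n} (hv : v ∈ Vn n) :
    PreservesRel ((T.invAcc q0).simA ⟨([], q0), ⟨[], rfl⟩⟩) (paperConj h v) := by
  intro α β _ _ hαβ
  obtain ⟨N, hN⟩ := exists_exchangesPrefix_transStar_eq hn hsync hv q0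
  obtain ⟨M, hM⟩ := h.symm.continuous.exists_prefix_length hn N
  refine (simA_invAcc_iff q0 _ _).2 ⟨M, fun w hw => ?_⟩
  obtain ⟨a, ha, haL⟩ := hM (α ++ w) (by simp [hw])
  obtain ⟨b, hab, hq⟩ := hN a ha.ge
  have hex : ExchangesPrefix (paperConj h v) (α ++ w) (β ++ w) :=
    ExchangesPrefix.append hαβ w
  generalize α ++ w = α at *
  generalize β ++ w = β at *
  have hv_mem : ∀ ρ, PrefixOf β (h (v ρ)) ↔ PrefixOf α (h ρ) := fun ρ => by
    simpa [paperConj] using hex.prefixOf_iff (x := h ρ)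
  have hA : ∀ ρ ∈ {ρ | PrefixOf α (h ρ)}, PrefixOf a ρ := fun ρ hρ => by
    obtain ⟨χ, hχ⟩ := PrefixOf.exists_eq hρ
    have := haL χ
    rwa [← hχ, Homeomorph.symm_apply_apply] at this
  have hB : ∀ ρ ∈ {ρ | PrefixOf β (h ρ)}, PrefixOf b ρ := fun ρ hρ => by
    have : PrefixOf α (h (v.symm ρ)) := (hv_mem _).1 (by simpa using hρ)
    simpa using hab.prefixOf (hA _ this)
  have hset : {ρ | appendInf b ρ ∈ {ρ | PrefixOf β (h ρ)}} =
      {ρ | appendInf a ρ ∈ {ρ | PrefixOf α (h ρ)}} := by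
    ext ρ
    change PrefixOf β (h (appendInf b ρ)) ↔ PrefixOf α (h (appendInf a ρ))
    rw [← hab ρ, hv_mem]
  obtain ⟨L, w₁, hL, hα, hs⟩ := exists_invState hn hind α
  obtain ⟨L', w₂, hL', hβ, hs'⟩ := exists_invState hn hind β
  have hneA := (nontrivial_preimage_cone hn h α).nonempty
  have hneB := (nontrivial_preimage_cone hn h β).nonempty
  obtain ⟨ρ, hρ⟩ := hneA
  obtain ⟨δ, rfl⟩ := (hA ρ hρ).prefix_of_length_le (hL.1 ρ hρ) (hL.2 a hA)
  have hLδ := hL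
  rw [isLCP_append_iff ⟨ρ, hρ⟩ hA, ← hset, ← isLCP_append_iff hneB hB] at hLδ
  obtain rfl := hLδ.unique hneB hL'
  have hq' : T.transStar (a ++ δ) q0 = T.transStar (b ++ δ) q0 := by
    rw [transStar_append, transStar_append, hq]
  rw [hs, hs', hq', Prod.mk.injEq]
  refine ⟨?_, rfl⟩
  refine List.append_cancel_left (as := T.outStar (b ++ δ) q0) ?_
  rw [← hβ]
  refine eq_of_forall_appendInf_eq hn fun χ => ?_
  obtain ⟨σ, hσ⟩ := (hL.1 (h.symm (appendInf α χ))
    (by simpa using prefixOf_appendInf α χ)).exists_eq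
  have hσ' := (Homeomorph.symm_apply_eq h).1 hσ
  rw [(hind.residual _).2, hα, appendInf_append] at hσ'
  have hσ'' := appendInf_injective _ hσ'
  rw [← hex χ]
  change _ = h (v (h.symm _))
  rw [hσ, (hab.append δ) σ, (hind.residual _).2, ← hq', ← hσ'', appendInf_append]

end Inverse

end Transducer

/-- Theorem 4.3. Let `T_{q0}` be an initial one-way synchronizing
transducer (possibly asynchronous) equal to its core, representing a homeomorphism `h`
of Cantor space, with inverse `S_{(ε,q0)}` given by the inversion algorithm, and let
`A` be the automaton obtained from `S` by forgetting outputs.  Then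
`Vₙ^{T_{q0}} = V_{∼_A}`, where `Vₙ^{T_{q0}} = T_{q0}⁻¹ Vₙ T_{q0}`. -/
theorem conjugate_subgroup_eq_VsimA_asynchronous
    {n : ℕ} (hn : 2 ≤ n) (T : Transducer n) [Finite T.Q] (q0 : T.Q)
    (h : Cantor n ≃ₜ Cantor n) (hAcc : T.Accessible q0)
    (hOne : T.OneWaySync q0 h) (hCore : T.EqualToCore) :
    paperConj h '' Vn n =
      ↑(VSim n ((T.invAcc q0).simA ⟨([], q0), ⟨[], rfl⟩⟩)) := by
  rw [paperConj_image_Vn hn h]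
  refine congrArg _ (le_antisymm ?_ ?_)
  · intro g hg
    refine Subgroup.subset_closure ?_
    have hg' : g ∈ paperConj h '' Vn n := by rw [paperConj_image_Vn hn h]; exact hg
    obtain ⟨v, hv, rfl⟩ := hg'
    exact ⟨Transducer.paperConj_mem_Vn hn hOne.1 hOne.2.1 hv,
      Transducer.preservesRel_paperConj hn hOne.1 hOne.2.1 hv⟩
  · exact (Subgroup.closure_le _).2 fun g hg =>
      Transducer.mem_conjVn_of_preservesRel hn hOne.1 hg.1 hg.2
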